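/- arXiv:2001.04862 — 2 statements merged into one kernel-verified Lean document; each statement's English description precedes it below -/
import Mathlib

section
/- There exists a constant C > 0 such that for every positive integer n and every Green function G of the ball B(n), one has G(v) ≤ C/n for every v ∈ ℤ² with n − 1 < |v| ≤ n. -/
noncomputable section

/-- Discrete Laplacian on the nearest-neighbor graph of `ℤ²`. -/
def lapZ (f : ℤ × ℤ → ℝ) (v : ℤ × ℤ) : ℝ :=
  4 * f v - (f (v.1 + 1, v.2) + f (v.1 - 1, v.2) + f (v.1, v.2 + 1) + f (v.1, v.2 - 1))

/-- Euclidean norm of a point of `ℤ²`. -/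
def znorm (v : ℤ × ℤ) : ℝ := Real.sqrt ((v.1 : ℝ) ^ 2 + (v.2 : ℝ) ^ 2)

/-- `G` is a Green function of the ball `B(n) = {v : |v| ≤ n}`. -/
def IsGreen (n : ℕ) (G : ℤ × ℤ → ℝ) : Prop :=
  (∀ v : ℤ × ℤ, (n : ℝ) < znorm v → G v = 0) ∧
  lapZ G (0, 0) = 1 ∧
  (∀ v : ℤ × ℤ, znorm v ≤ (n : ℝ) → v ≠ (0, 0) → lapZ G v = 0)

theorem znorm_sq (v : ℤ × ℤ) : znorm v ^ 2 = (v.1 : ℝ) ^ 2 + (v.2 : ℝ) ^ 2 :=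
  Real.sq_sqrt (by positivity)

theorem znorm_nonneg (v : ℤ × ℤ) : 0 ≤ znorm v := Real.sqrt_nonneg _

theorem znorm_le_add_znorm_sub (v w : ℤ × ℤ) : znorm w ≤ znorm v + znorm (w - v) := by
  have h := norm_add_le (⟨v.1, v.2⟩ : ℂ) ⟨((w - v).1 : ℤ), ((w - v).2 : ℤ)⟩
  have key : ∀ x y : ℝ, ‖(⟨x, y⟩ : ℂ)‖ = Real.sqrt (x ^ 2 + y ^ 2) := fun x y => by
    rw [Complex.norm_def, Complex.normSq_mk, sq, sq]
  have hadd : (⟨v.1, v.2⟩ : ℂ) + ⟨((w - v).1 : ℤ), ((w - v).2 : ℤ)⟩ = ⟨w.1, w.2⟩ := by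
    apply Complex.ext <;> simp
  rw [hadd, key, key, key] at h
  exact h

theorem finite_znorm_le (r : ℝ) : {v : ℤ × ℤ | znorm v ≤ r}.Finite := by
  refine (Set.finite_Icc ((-⌈r⌉, -⌈r⌉) : ℤ × ℤ) (⌈r⌉, ⌈r⌉)).subset fun v hv => ?_
  have h1 : |(v.1 : ℝ)| ≤ r :=
    (Real.abs_le_sqrt (le_add_of_nonneg_right (sq_nonneg (v.2 : ℝ)))).trans hv
  have h2 : |(v.2 : ℝ)| ≤ r :=
    (Real.abs_le_sqrt (le_add_of_nonneg_left (sq_nonneg (v.1 : ℝ)))).trans hv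
  have hr : r ≤ (⌈r⌉ : ℝ) := Int.le_ceil r
  have h1' : |v.1| ≤ ⌈r⌉ := by exact_mod_cast h1.trans hr
  have h2' : |v.2| ≤ ⌈r⌉ := by exact_mod_cast h2.trans hr
  rw [abs_le] at h1' h2'
  exact ⟨⟨h1'.1, h2'.1⟩, ⟨h1'.2, h2'.2⟩⟩

/-- Maximum principle for strictly subharmonic functions on a finite set. -/
theorem le_of_lapZ_neg {S : Set (ℤ × ℤ)} (hS : S.Finite) {f : ℤ × ℤ → ℝ} {c : ℝ}
    (hf : ∀ v ∈ S, lapZ f v < 0)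
    (hc : ∀ v ∈ S, ∀ w ∉ S, znorm (w - v) ≤ 1 → f w ≤ c) {v : ℤ × ℤ} (hv : v ∈ S) :
    f v ≤ c := by
  by_contra! hlt
  obtain ⟨u, hu, hmax⟩ := hS.exists_maximalFor f S ⟨v, hv⟩
  have hmax' : ∀ w ∈ S, f w ≤ f u := fun w hw =>
    (le_total (f w) (f u)).elim id fun h => hmax hw h
  have hnear : ∀ w, znorm (w - u) ≤ 1 → f w ≤ f u := fun w hw => by
    by_cases hwS : w ∈ S
    · exact hmax' w hwS
    · exact (hc u hu w hwS hw).trans (hlt.le.trans (hmax' v hv))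
  have h1 := hnear (u.1 + 1, u.2) (by simp [znorm])
  have h2 := hnear (u.1 - 1, u.2) (by simp [znorm])
  have h3 := hnear (u.1, u.2 + 1) (by simp [znorm])
  have h4 := hnear (u.1, u.2 - 1) (by simp [znorm])
  have h := hf u hu
  unfold lapZ at h
  linarith

/-- A smoothed logarithm on `ℤ²`; it is strictly subharmonic. -/
def smoothLog (v : ℤ × ℤ) : ℝ := Real.log (znorm v ^ 2 + 1)

theorem lapZ_add (f g : ℤ × ℤ → ℝ) (v : ℤ × ℤ) :
    lapZ (fun w => f w + g w) v = lapZ f v + lapZ g v := by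
  unfold lapZ
  ring

theorem lapZ_smoothLog_neg (v : ℤ × ℤ) : lapZ smoothLog v < 0 := by
  obtain ⟨a, b⟩ := v
  simp only [lapZ, smoothLog, znorm_sq, Int.cast_add, Int.cast_sub, Int.cast_one]
  generalize (a : ℝ) = x
  generalize (b : ℝ) = y
  have hprod : (x ^ 2 + y ^ 2 + 1) ^ 4 <
      ((x + 1) ^ 2 + y ^ 2 + 1) * ((x - 1) ^ 2 + y ^ 2 + 1) *
        (x ^ 2 + (y + 1) ^ 2 + 1) * (x ^ 2 + (y - 1) ^ 2 + 1) := by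
    have hs : 0 < x ^ 2 + y ^ 2 + 1 := by positivity
    nlinarith [sq_nonneg (x * y), sq_nonneg (x ^ 2 + y ^ 2 + 1)]
  have hlog := Real.log_lt_log (by positivity) hprod
  rw [Real.log_pow, Real.log_mul (by positivity) (by positivity),
    Real.log_mul (by positivity) (by positivity),
    Real.log_mul (by positivity) (by positivity)] at hlog
  push_cast at hlog
  linarith

theorem lapZ_smoothLog_zero : lapZ smoothLog (0, 0) = -(4 * Real.log 2) := by
  simp [lapZ, smoothLog, znorm_sq]
  norm_num
  ring

theorem smoothLog_le_log {v : ℤ × ℤ} {r : ℝ} (h : znorm v ≤ r) :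
    smoothLog v ≤ Real.log (r ^ 2 + 1) := by
  have := znorm_nonneg v
  exact Real.log_le_log (by positivity) (by gcongr)

theorem IsGreen.le_log_sub_smoothLog {n : ℕ} {G : ℤ × ℤ → ℝ} (hG : IsGreen n G) {v : ℤ × ℤ}
    (hv : znorm v ≤ n) : G v ≤ Real.log (((n : ℝ) + 1) ^ 2 + 1) - smoothLog v := by
  obtain ⟨hout, hzero, hharm⟩ := hG
  refine le_sub_iff_add_le.2 (le_of_lapZ_neg (f := fun w => G w + smoothLog w)
    (finite_znorm_le n) (fun u hu => ?_) (fun u hu w hw huw => ?_) hv)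
  · rw [lapZ_add]
    by_cases hu0 : u = (0, 0)
    · rw [hu0, hzero, lapZ_smoothLog_zero]
      linarith [Real.log_two_gt_d9]
    · rw [hharm u hu hu0, zero_add]
      exact lapZ_smoothLog_neg u
  · have hu' : znorm u ≤ n := hu
    have hwn : znorm w ≤ n + 1 := by linarith [znorm_le_add_znorm_sub u w]
    simp only [hout w (not_le.1 hw), zero_add]
    exact smoothLog_le_log hwn

theorem log_sub_smoothLog_le {n : ℕ} (hn : 0 < n) {v : ℤ × ℤ} (hv : (n : ℝ) - 1 < znorm v) :
    Real.log (((n : ℝ) + 1) ^ 2 + 1) - smoothLog v ≤ 8 / n := by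
  have hn1 : (1 : ℝ) ≤ n := by exact_mod_cast hn
  have hsq : ((n : ℝ) - 1) ^ 2 ≤ znorm v ^ 2 := by gcongr
  have hpos : (0 : ℝ) < znorm v ^ 2 + 1 := by positivity
  rw [smoothLog, ← Real.log_div (by positivity) hpos.ne']
  refine (Real.log_le_sub_one_of_pos (by positivity)).trans ?_
  rw [div_sub_one hpos.ne', div_le_div_iff₀ hpos (by linarith)]
  nlinarith [sq_nonneg ((n : ℝ) - 2), mul_le_mul_of_nonneg_right hsq (by linarith : (0 : ℝ) ≤ n)]

/-- On the boundary sphere `n - 1 < |v| ≤ n`, a Green function of `B(n)` is `O(1/n)`. -/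
theorem green_boundary_bound :
    ∃ C : ℝ, 0 < C ∧ ∀ n : ℕ, 0 < n → ∀ G : ℤ × ℤ → ℝ, IsGreen n G →
      ∀ v : ℤ × ℤ, (n : ℝ) - 1 < znorm v → znorm v ≤ (n : ℝ) → G v ≤ C / n := by
  exact ⟨8, by norm_num, fun n hn G hG v hlow hup =>
    (hG.le_log_sub_smoothLog hup).trans (log_sub_smoothLog_le hn hlow)⟩
end
end

section
/- There exists a constant C > 0 such that for every positive integer n, every Green function G of the ball B(n), and every v ∈ ℤ² with |v| ≤ n, one has G(v) ≤ C·log((n + 2)/(|v| + 1)). -/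
noncomputable section

/-- The function `v ↦ log (|v|² + 1)`, which is strictly subharmonic on `ℤ²`. -/
def logPotential (v : ℤ × ℤ) : ℝ := Real.log ((v.1 : ℝ) ^ 2 + (v.2 : ℝ) ^ 2 + 1)

theorem znorm_le_iff {v : ℤ × ℤ} {r : ℝ} (hr : 0 ≤ r) :
    znorm v ≤ r ↔ (v.1 : ℝ) ^ 2 + (v.2 : ℝ) ^ 2 ≤ r ^ 2 :=
  Real.sqrt_le_left hr

theorem lapZ_logPotential_neg (v : ℤ × ℤ) : lapZ logPotential v < 0 := by
  obtain ⟨a, b⟩ := v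
  simp only [lapZ, logPotential]
  push_cast
  set x : ℝ := (a : ℝ)
  set y : ℝ := (b : ℝ)
  rw [← Real.log_mul (by positivity) (by positivity), ← Real.log_mul (by positivity) (by positivity),
    ← Real.log_mul (by positivity) (by positivity), sub_neg,
    show (4 : ℝ) = ((4 : ℕ) : ℝ) by norm_num, ← Real.log_pow]
  refine Real.log_lt_log (by positivity) ?_
  have hpos : 0 < 2 * (x ^ 2 + y ^ 2 + 1) ^ 2 + 8 * (x ^ 2 + y ^ 2 + 1) + 5 + 16 * x ^ 2 * y ^ 2 := by
    positivity
  nlinarith only [hpos]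

theorem lapZ_logPotential_zero : lapZ logPotential (0, 0) < -2 := by
  have h := Real.log_two_gt_d9
  norm_num [lapZ, logPotential]
  linarith

theorem lapZ_const_sub_mul_sub (c k : ℝ) (f G : ℤ × ℤ → ℝ) (v : ℤ × ℤ) :
    lapZ (fun w => k * (c - f w) - G w) v = -k * lapZ f v - lapZ G v := by
  simp only [lapZ]
  ring

theorem finite_setOf_znorm_le (n : ℕ) : {v : ℤ × ℤ | znorm v ≤ n}.Finite := by
  refine (Set.finite_Icc ((-n, -n) : ℤ × ℤ) (n, n)).subset fun v hv => ?_
  rw [Set.mem_ofPred_eq, znorm_le_iff (by positivity)] at hv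
  have h : v.1 ^ 2 + v.2 ^ 2 ≤ (n : ℤ) ^ 2 := by exact_mod_cast hv
  have h1 := abs_le_of_sq_le_sq' (show v.1 ^ 2 ≤ (n : ℤ) ^ 2 by nlinarith [sq_nonneg v.2])
    (by positivity)
  have h2 := abs_le_of_sq_le_sq' (show v.2 ^ 2 ≤ (n : ℤ) ^ 2 by nlinarith [sq_nonneg v.1])
    (by positivity)
  exact ⟨⟨h1.1, h2.1⟩, ⟨h1.2, h2.2⟩⟩

/-- Minimum principle for strictly superharmonic functions on a ball. -/
theorem nonneg_of_lapZ_pos {n : ℕ} {u : ℤ × ℤ → ℝ}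
    (hu : ∀ v, znorm v ≤ n → 0 < lapZ u v)
    (hbd : ∀ v, (n : ℝ) < znorm v → znorm v ≤ n + 1 → 0 ≤ u v)
    {v : ℤ × ℤ} (hv : znorm v ≤ n) : 0 ≤ u v := by
  obtain ⟨w, hw, hmin⟩ := Set.exists_min_image _ u (finite_setOf_znorm_le (n + 1))
    ⟨v, by simpa using hv.trans (by linarith)⟩
  simp only [Set.mem_ofPred_eq, Nat.cast_add, Nat.cast_one] at hw hmin
  refine le_trans ?_ (hmin v (hv.trans (by linarith)))
  rcases lt_or_ge (n : ℝ) (znorm w) with hout | hin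
  · exact hbd w hout hw
  · exfalso
    have hpos := hu w hin
    rw [znorm_le_iff (by positivity)] at hin
    have hx := abs_le_of_sq_le_sq'
      (show (w.1 : ℝ) ^ 2 ≤ (n : ℝ) ^ 2 by nlinarith [sq_nonneg (w.2 : ℝ)])
      (by positivity)
    have hy := abs_le_of_sq_le_sq'
      (show (w.2 : ℝ) ^ 2 ≤ (n : ℝ) ^ 2 by nlinarith [sq_nonneg (w.1 : ℝ)])
      (by positivity)
    have hnb : ∀ z : ℤ × ℤ, (z.1 : ℝ) ^ 2 + (z.2 : ℝ) ^ 2 ≤ ((n : ℝ) + 1) ^ 2 → u w ≤ u z :=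
      fun z hz => hmin z ((znorm_le_iff (by positivity)).2 hz)
    have h1 := hnb (w.1 + 1, w.2) (by push_cast; nlinarith)
    have h2 := hnb (w.1 - 1, w.2) (by push_cast; nlinarith)
    have h3 := hnb (w.1, w.2 + 1) (by push_cast; nlinarith)
    have h4 := hnb (w.1, w.2 - 1) (by push_cast; nlinarith)
    rw [lapZ] at hpos
    linarith

/-- The function `s ↦ (s + 1)³ / (s² + 1)` is monotone on `[0, ∞)`, in logarithmic form. -/
theorem log_sq_add_one_sub_le {r m : ℝ} (hr : 0 ≤ r) (hrm : r ≤ m) :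
    Real.log (m ^ 2 + 1) - Real.log (r ^ 2 + 1) ≤ 3 * Real.log ((m + 1) / (r + 1)) := by
  have hm : 0 ≤ m := hr.trans hrm
  rw [← Real.log_div (by positivity) (by positivity), show (3 : ℝ) = ((3 : ℕ) : ℝ) by norm_num,
    ← Real.log_pow, div_pow]
  refine Real.log_le_log (by positivity) ?_
  rw [div_le_div_iff₀ (by positivity) (by positivity)]
  obtain ⟨d, rfl⟩ : ∃ d, m = r + d := ⟨m - r, by ring⟩
  have hd : 0 ≤ d := by linarith
  have h : 0 ≤ d * ((r + 1) ^ 2 * ((r - 1) ^ 2 + 2)) + d ^ 2 * ((r + 1) * (r ^ 2 + (r - 1) ^ 2 + 1))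
      + d ^ 3 * (r ^ 2 + 1) := by positivity
  nlinarith only [h]

/-- Logarithmic pointwise bound on Green functions of balls. -/
theorem green_log_bound :
    ∃ C : ℝ, 0 < C ∧ ∀ n : ℕ, 0 < n → ∀ G : ℤ × ℤ → ℝ, IsGreen n G →
      ∀ v : ℤ × ℤ, znorm v ≤ (n : ℝ) →
        G v ≤ C * Real.log (((n : ℝ) + 2) / (znorm v + 1)) := by
  refine ⟨3 / 2, by norm_num, fun n _ G hG v hv => ?_⟩
  obtain ⟨hout, hzero, hharm⟩ := hG
  have hcomp : 0 ≤ 1 / 2 * (Real.log (((n : ℝ) + 1) ^ 2 + 1) - logPotential v) - G v := by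
    refine nonneg_of_lapZ_pos
      (u := fun w => 1 / 2 * (Real.log (((n : ℝ) + 1) ^ 2 + 1) - logPotential w) - G w)
      (fun w hw => ?_) (fun w hw hw' => ?_) hv
    · rw [lapZ_const_sub_mul_sub]
      rcases eq_or_ne w (0, 0) with rfl | hne
      · linarith [lapZ_logPotential_zero]
      · linarith [lapZ_logPotential_neg w, hharm w hw hne]
    · rw [znorm_le_iff (by positivity)] at hw'
      have hlog : logPotential w ≤ Real.log (((n : ℝ) + 1) ^ 2 + 1) :=
        Real.log_le_log (by positivity) (by linarith)
      simp only [hout w hw]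
      linarith
  have hlog := log_sq_add_one_sub_le (r := znorm v) (m := n + 1) (Real.sqrt_nonneg _) (by linarith)
  rw [znorm_sq, show (n : ℝ) + 1 + 1 = n + 2 by ring] at hlog
  rw [logPotential] at hcomp
  linarith
end
end
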